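/- Lower energy bound for the maximizer: fix δ ∈ (0, δ0/2). There exist C > 0 and λ1 > 0, independent of λ, such that for every λ ≥ λ1 and every maximizer (ω^λ, x_{p+1}^λ, …, x_k^λ) of ℰ over N_p^λ × B̄_δ(x̄_{p+1}) × ⋯ × B̄_δ(x̄_k), one has E(ω^λ) ≥ −(1/4π)·Σ_{i=1}^p κ_i² ln ε_i − C, where ε_i = (|κ_i|/(πλ))^{1/2} (i.e. λπε_i² = |κ_i|). -/

import Mathlib

open MeasureTheory Metric Real Filter Topology

noncomputable section

abbrev E2 := EuclideanSpace ℝ (Fin 2)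

/-- The logarithm of the norm is integrable on every disc centred at the origin. -/
lemma integrableOn_log_norm_ball (R : ℝ) :
    IntegrableOn (fun v : E2 => Real.log ‖v‖) (ball 0 R) := by
  rw [integrableOn_fun_norm_addHaar (volume : Measure E2) (f := Real.log)]
  have hc : Continuous fun y : ℝ => y * Real.log y := Real.continuous_mul_log
  refine ((hc.integrableOn_Icc (a := 0) (b := R)).mono_set Set.Ioo_subset_Icc_self).congr_fun
    (fun y _ => ?_) measurableSet_Ioo
  simp

/-- The logarithmic kernel is integrable on the square of a bounded measurable set. -/
lemma integrableOn_log_dist {K : Set E2} (hK : Bornology.IsBounded K) (hKm : MeasurableSet K) :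
    IntegrableOn (fun q : E2 × E2 => Real.log (dist q.1 q.2)) (K ×ˢ K)
      (volume.prod volume) := by
  obtain ⟨R, hR⟩ := hK.subset_ball (0 : E2)
  have hf : Integrable (K.indicator fun _ => (1 : ℝ)) (volume : Measure E2) :=
    (integrable_indicator_iff hKm).2 (integrableOn_const hK.measure_lt_top.ne)
  have hg : Integrable ((ball (0 : E2) (R + R)).indicator fun v => Real.log ‖v‖) volume :=
    (integrable_indicator_iff measurableSet_ball).2 (integrableOn_log_norm_ball _)
  have hconv := hf.convolution_integrand (ContinuousLinearMap.mul ℝ ℝ) hg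
  refine hconv.integrableOn.congr_fun (s := K ×ˢ K) (fun q hq => ?_) (hKm.prod hKm)
  have h1 := hR hq.1
  have h2 := hR hq.2
  rw [mem_ball_zero_iff] at h1 h2
  have h3 : q.1 - q.2 ∈ ball (0 : E2) (R + R) := by
    rw [mem_ball_zero_iff]
    exact (norm_sub_le _ _).trans_lt (add_lt_add h1 h2)
  simp [Set.indicator_of_mem hq.2, Set.indicator_of_mem h3, dist_eq_norm]

/-- Almost every pair of points of the plane consists of two distinct points. -/
lemma ae_prod_ne : ∀ᵐ q : E2 × E2 ∂(volume.prod volume), q.1 ≠ q.2 := by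
  have : (volume.prod volume) {q : E2 × E2 | q.1 = q.2} = 0 := by
    rw [Measure.measure_prod_null (measurableSet_eq_fun measurable_fst measurable_snd)]
    refine Eventually.of_forall fun x => ?_
    have : Prod.mk x ⁻¹' {q : E2 × E2 | q.1 = q.2} = {x} := by
      ext y
      simp [eq_comm]
    simp [this]
  simpa [ae_iff] using this

/-- Lower bound for the double integral of a kernel against a finite combination of
indicator functions, from pointwise lower bounds off the diagonal. -/
lemma sum_le_double_integral {ι : Type*} [Fintype ι] {G : E2 → E2 → ℝ} {D K : Set E2}
    (hKD : K ⊆ D)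
    (hG : IntegrableOn (fun q : E2 × E2 => G q.1 q.2) (K ×ˢ K) (volume.prod volume))
    {B : ι → Set E2} (hBm : ∀ i, MeasurableSet (B i)) (hBK : ∀ i, B i ⊆ K)
    (hBfin : ∀ i, volume (B i) ≠ ⊤) (a : ι → ℝ) (m : ι → ι → ℝ)
    (hm : ∀ i j, ∀ x ∈ B i, ∀ y ∈ B j, x ≠ y → m i j * |a i| * |a j| ≤ G x y * a i * a j) :
    ∑ i, ∑ j, m i j * (|a i| * volume.real (B i)) * (|a j| * volume.real (B j)) ≤
      ∫ x in D, ∫ y in D, G x y * (∑ i, (B i).indicator fun _ => a i) x *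
        (∑ i, (B i).indicator fun _ => a i) y := by
  set F : ι → ι → E2 × E2 → ℝ := fun i j =>
    (B i ×ˢ B j).indicator fun q => G q.1 q.2 * a i * a j
  have hset : ∀ i j, MeasurableSet (B i ×ˢ B j) := fun i j => (hBm i).prod (hBm j)
  have hsub : ∀ i j, B i ×ˢ B j ⊆ K ×ˢ K := fun i j => Set.prod_mono (hBK i) (hBK j)
  have hint : ∀ i j, IntegrableOn (fun q : E2 × E2 => G q.1 q.2 * a i * a j) (B i ×ˢ B j)
      (volume.prod volume) := fun i j =>
    ((hG.mono_set (hsub i j)).mul_const (a i)).mul_const (a j)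
  have hF : ∀ i j, Integrable (F i j) (volume.prod volume) := fun i j =>
    (integrable_indicator_iff (hset i j)).2 (hint i j)
  have hsum : (fun q : E2 × E2 => G q.1 q.2 * (∑ i, (B i).indicator fun _ => a i) q.1 *
      (∑ i, (B i).indicator fun _ => a i) q.2) = fun q => ∑ i, ∑ j, F i j q := by
    funext q
    simp only [Finset.sum_apply, Finset.mul_sum, Finset.sum_mul, F]
    rw [Finset.sum_comm]
    refine Finset.sum_congr rfl fun i _ => Finset.sum_congr rfl fun j _ => ?_
    by_cases h1 : q.1 ∈ B i <;> by_cases h2 : q.2 ∈ B j <;> simp [h1, h2]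
  have hFs : Integrable (fun q => ∑ i, ∑ j, F i j q) (volume.prod volume) :=
    integrable_finsetSum _ fun i _ => integrable_finsetSum _ fun j _ => hF i j
  have hprod := setIntegral_prod (μ := volume) (ν := volume)
    (fun q : E2 × E2 => G q.1 q.2 * (∑ i, (B i).indicator fun _ => a i) q.1 *
      (∑ i, (B i).indicator fun _ => a i) q.2) (s := D) (t := D)
    (by rw [hsum]; exact hFs.integrableOn)
  rw [← hprod, hsum, integral_finsetSum _ fun i _ =>
    integrable_finsetSum _ fun j _ => (hF i j).integrableOn]
  refine Finset.sum_le_sum fun i _ => ?_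
  rw [integral_finsetSum _ fun j _ => (hF i j).integrableOn]
  refine Finset.sum_le_sum fun j _ => ?_
  have hDset : (D ×ˢ D) ∩ (B i ×ˢ B j) = B i ×ˢ B j :=
    Set.inter_eq_right.2 ((hsub i j).trans (Set.prod_mono hKD hKD))
  rw [setIntegral_indicator (hset i j), hDset]
  have hfin : (volume.prod volume) (B i ×ˢ B j) ≠ ⊤ := by
    rw [Measure.prod_prod]
    exact ENNReal.mul_ne_top (hBfin i) (hBfin j)
  calc m i j * (|a i| * volume.real (B i)) * (|a j| * volume.real (B j))
      = ∫ _ in B i ×ˢ B j, m i j * |a i| * |a j| ∂(volume.prod volume) := by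
        rw [setIntegral_const, measureReal_prod_prod, smul_eq_mul]
        ring
    _ ≤ _ := by
        refine setIntegral_mono_on_ae (integrableOn_const hfin) (hint i j) (hset i j) ?_
        filter_upwards [ae_prod_ne] with q hq hqB
        exact hm i j _ hqB.1 _ hqB.2 hq

/-- A kernel bounded by `M` integrates against a combination of signed patches of circulations
`c i` to at most `M * ∑ |c i|`. -/
lemma abs_integral_mul_sum_le {ι : Type*} [Fintype ι] {D : Set E2} {w : ι → E2 → ℝ} {c : ι → ℝ}
    (hc : ∀ i, c i ≠ 0) (hw : ∀ i, ∫ x in D, w i x = c i)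
    (hsign : ∀ i, ∀ᵐ x, 0 ≤ Real.sign (c i) * w i x) {g : E2 → ℝ} {M : ℝ}
    (hg : ∀ i x, w i x ≠ 0 → |g x| ≤ M) :
    |∫ x in D, g x * (∑ i, w i) x| ≤ M * ∑ i, |c i| := by
  have hwi : ∀ i, IntegrableOn (w i) D := fun i => by
    by_contra hn
    exact hc i ((hw i).symm.trans (integral_undef hn))
  have habs : ∀ i, ∫ x in D, |w i x| = |c i| := fun i => by
    have h1 : ∀ᵐ x ∂(volume.restrict D), |w i x| = Real.sign (c i) * w i x := by
      filter_upwards [ae_restrict_of_ae (hsign i)] with x hx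
      rcases lt_or_gt_of_ne (hc i) with h | h
      · rw [Real.sign_of_neg h] at hx ⊢
        rw [abs_of_nonpos (by linarith)]
        ring
      · rw [Real.sign_of_pos h] at hx ⊢
        rw [abs_of_nonneg (by linarith)]
        ring
    rw [integral_congr_ae h1, integral_const_mul, hw i]
    rcases lt_or_gt_of_ne (hc i) with h | h
    · rw [Real.sign_of_neg h, abs_of_neg h]
      ring
    · rw [Real.sign_of_pos h, abs_of_pos h]
      ring
  have hint : Integrable (fun x => ∑ i, M * |w i x|) (volume.restrict D) :=
    integrable_finsetSum _ fun i _ => (hwi i).abs.const_mul M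
  calc |∫ x in D, g x * (∑ i, w i) x| ≤ ∫ x in D, ∑ i, M * |w i x| := by
        rw [← Real.norm_eq_abs]
        refine norm_integral_le_of_norm_le hint (Eventually.of_forall fun x => ?_)
        rw [Finset.sum_apply, Finset.mul_sum, Real.norm_eq_abs]
        refine (Finset.abs_sum_le_sum_abs _ _).trans (Finset.sum_le_sum fun i _ => ?_)
        rw [abs_mul]
        rcases eq_or_ne (w i x) 0 with h0 | h0
        · simp [h0]
        · exact mul_le_mul_of_nonneg_right (hg i x h0) (abs_nonneg _)
    _ = M * ∑ i, |c i| := by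
        rw [integral_finsetSum _ fun i _ => (hwi i).abs.const_mul M, Finset.mul_sum]
        simp only [integral_const_mul, habs]

/-- The area of a disc in the plane. -/
lemma volume_real_ball (x : E2) {r : ℝ} (hr : 0 ≤ r) : volume.real (ball x r) = π * r ^ 2 := by
  rw [Measure.real, EuclideanSpace.volume_ball_fin_two, ENNReal.toReal_mul, ENNReal.toReal_pow,
    ENNReal.toReal_ofReal hr, ENNReal.toReal_ofReal pi_pos.le, mul_comm]

theorem energy_lower_bound
    (p l : ℕ) (hp : 0 < p) (hl : 0 < l)
    (D : Set E2) (hDopen : IsOpen D) (hDbdd : Bornology.IsBounded D)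
    (hDsc : SimplyConnectedSpace D)
    (h : E2 → E2 → ℝ)
    (hcont : ContinuousOn (fun q : E2 × E2 => h q.1 q.2) (D ×ˢ D))
    (hsymm : ∀ x ∈ D, ∀ y ∈ D, h x y = h y x)
    (hharm : ∀ y ∈ D, ContDiffOn ℝ 2 (fun x => h x y) D ∧
      ∀ x ∈ D, ∑ i : Fin 2,
        iteratedFDerivWithin ℝ 2 (fun x' => h x' y) D x
          ![EuclideanSpace.single i 1, EuclideanSpace.single i 1] = 0)
    (G : E2 → E2 → ℝ)
    (hG : ∀ x y, G x y = (1 / (2 * π)) * Real.log (1 / dist x y) - h x y)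
    (hGbdry : ∀ y ∈ D, ∀ z ∈ frontier D,
      Tendsto (fun x => G x y) (𝓝[D] z) (𝓝 0))
    (κ : Fin (p + l) → ℝ) (hκ : ∀ i, κ i ≠ 0)
    (xb : Fin (p + l) → E2) (hxbD : ∀ i, xb i ∈ D) (hxbinj : Function.Injective xb)
    (δ0 : ℝ) (hδ0 : 0 < δ0)
    (hball : ∀ i, closedBall (xb i) δ0 ⊆ D)
    (hdisj : ∀ i j, i ≠ j → Disjoint (closedBall (xb i) δ0) (closedBall (xb j) δ0))
    (KR : (Fin (p + l) → E2) → ℝ)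
    (hKR : ∀ y, KR y =
      -(∑ i, ∑ j ∈ Finset.univ.filter (fun j => j ≠ i), κ i * κ j * G (y i) (y j))
      + ∑ i, (κ i) ^ 2 * h (y i) (y i))
    (hmin : ∀ y : Fin (p + l) → E2, (∀ i, y i ∈ closedBall (xb i) δ0) →
      Function.Injective y → y ≠ xb → KR xb < KR y)
    (ψ : (E2 → ℝ) → E2 → ℝ)
    (hψ : ∀ ω x, ψ ω x = ∫ y in D, G x y * ω y)
    (En : (E2 → ℝ) → ℝ)
    (hEn : ∀ ω, En ω = (1 / 2) * ∫ x in D, ∫ y in D, G x y * ω x * ω y)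
    (EE : (E2 → ℝ) → (Fin l → E2) → ℝ)
    (hEE : ∀ ω z, EE ω z = En ω
      + ∑ j, κ (Fin.natAdd p j) * ψ ω (z j)
      + (1 / 2) * ∑ i, ∑ j ∈ Finset.univ.filter (fun j => j ≠ i),
          κ (Fin.natAdd p i) * κ (Fin.natAdd p j) * G (z i) (z j)
      - ∑ j, (κ (Fin.natAdd p j)) ^ 2 * ((1 / 2) * h (z j) (z j)))
    (Adm : ℝ → ℝ → (Fin p → E2 → ℝ) → Prop)
    (hAdm : ∀ δ lam ωs, Adm δ lam ωs ↔ ∀ i : Fin p,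
      Measurable (ωs i)
      ∧ (∀ x, x ∉ ball (xb (Fin.castAdd l i)) δ → ωs i x = 0)
      ∧ (∫ x in D, ωs i x) = κ (Fin.castAdd l i)
      ∧ (∀ᵐ x : E2 ∂volume, 0 ≤ Real.sign (κ (Fin.castAdd l i)) * ωs i x
          ∧ Real.sign (κ (Fin.castAdd l i)) * ωs i x ≤ lam))
    (δ : ℝ) (hδ : 0 < δ) (hδ2 : δ < δ0 / 2)
    :
    ∃ C > 0, ∃ lam1 > 0, ∀ lam, lam1 ≤ lam →
      ∀ (ωs : Fin p → E2 → ℝ) (z : Fin l → E2),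
      (Adm δ lam ωs ∧ (∀ j, z j ∈ closedBall (xb (Fin.natAdd p j)) δ) ∧
      (∀ (ωs' : Fin p → E2 → ℝ) (z' : Fin l → E2), Adm δ lam ωs' →
        (∀ j, z' j ∈ closedBall (xb (Fin.natAdd p j)) δ) →
        EE (∑ i, ωs' i) z' ≤ EE (∑ i, ωs i) z)) →
      -(1 / (4 * π)) * (∑ i : Fin p, (κ (Fin.castAdd l i)) ^ 2 *
          Real.log (Real.sqrt (|κ (Fin.castAdd l i)| / (π * lam)))) - C ≤ En (∑ i, ωs i) := by
  set T : ℝ := ∑ i : Fin p, |κ (Fin.castAdd l i)| with hT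
  set S : ℝ := ∑ j : Fin l, |κ (Fin.natAdd p j)| with hS
  have hT0 : 0 ≤ T := Finset.sum_nonneg fun _ _ => abs_nonneg _
  have hS0 : 0 ≤ S := Finset.sum_nonneg fun _ _ => abs_nonneg _
  have hδδ0 : δ < δ0 := by linarith
  set K : Set E2 := ⋃ i, closedBall (xb i) δ with hK
  have hKc : IsCompact K := isCompact_iUnion fun i => isCompact_closedBall _ _
  have hKm : MeasurableSet K := hKc.measurableSet
  have hKD : K ⊆ D :=
    Set.iUnion_subset fun i => (closedBall_subset_closedBall hδδ0.le).trans (hball i)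
  have hxK : ∀ i, closedBall (xb i) δ ⊆ K := fun i =>
    Set.subset_iUnion (fun i => closedBall (xb i) δ) i
  have hhK : ContinuousOn (fun q : E2 × E2 => h q.1 q.2) (K ×ˢ K) :=
    hcont.mono (Set.prod_mono hKD hKD)
  obtain ⟨M2, hM2⟩ := (hKc.prod hKc).exists_bound_of_continuousOn hhK
  have hGfar : ContinuousOn (fun q : E2 × E2 => G q.1 q.2)
      ((K ×ˢ K) ∩ {q | δ0 / 2 ≤ dist q.1 q.2}) := by
    simp only [hG]
    refine ContinuousOn.sub (continuousOn_const.mul (ContinuousOn.log ?_ ?_))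
      (hhK.mono Set.inter_subset_left)
    · refine continuousOn_const.div continuous_dist.continuousOn fun q hq => ?_
      have : δ0 / 2 ≤ dist q.1 q.2 := hq.2
      linarith
    · intro q hq
      have : δ0 / 2 ≤ dist q.1 q.2 := hq.2
      have : 0 < dist q.1 q.2 := by linarith
      positivity
  obtain ⟨M1, hM1⟩ := ((hKc.prod hKc).inter_right
    (isClosed_le continuous_const continuous_dist)).exists_bound_of_continuousOn hGfar
  set M : ℝ := |M1| + |M2| + Real.log 2 / (2 * π) with hM
  have hlog2 : 0 ≤ Real.log 2 / (2 * π) :=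
    div_nonneg (Real.log_nonneg (by norm_num)) (by positivity)
  have hM0 : 0 ≤ M := by positivity
  have hGM : ∀ i j, i ≠ j → ∀ x ∈ closedBall (xb i) δ, ∀ y ∈ closedBall (xb j) δ,
      |G x y| ≤ M := by
    intro i j hij x hx y hy
    have hd : δ0 / 2 ≤ dist x y := by
      have h1 : xb i ∈ closedBall (xb i) δ0 := mem_closedBall_self hδ0.le
      have h2 : y ∉ closedBall (xb i) δ0 := fun hyi =>
        Set.disjoint_left.1 (hdisj i j hij) hyi (closedBall_subset_closedBall hδδ0.le hy)
      rw [mem_closedBall, not_le] at h2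
      rw [mem_closedBall] at hx
      have := dist_triangle y x (xb i)
      rw [dist_comm y x] at this
      linarith
    have := hM1 (x, y) ⟨⟨hxK i hx, hxK j hy⟩, hd⟩
    rw [Real.norm_eq_abs] at this
    have := le_abs_self M1
    have := abs_nonneg M2
    simp only at *
    linarith
  have hGint : IntegrableOn (fun q : E2 × E2 => G q.1 q.2) (K ×ˢ K) (volume.prod volume) := by
    have h1 := (integrableOn_log_dist hKc.isBounded hKm).const_mul (-(1 / (2 * π)))
    have h2 : IntegrableOn (fun q : E2 × E2 => h q.1 q.2) (K ×ˢ K) (volume.prod volume) :=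
      hhK.integrableOn_compact (hKc.prod hKc)
    refine (h1.sub h2).congr (Eventually.of_forall fun q => ?_)
    simp [hG, Real.log_inv]
  refine ⟨M * T ^ 2 / 2 + 2 * (S * (M * T)) + 1, by positivity,
    T / (π * δ ^ 2) + 1, by positivity, ?_⟩
  rintro lam hlam ωs z ⟨hadm, hz, hmax⟩
  have hlam0 : 0 < lam := lt_of_lt_of_le (by positivity) hlam
  set c : Fin p → ℝ := fun i => κ (Fin.castAdd l i) with hc
  have hc0 : ∀ i, c i ≠ 0 := fun i => hκ _
  set ε : Fin p → ℝ := fun i => Real.sqrt (|c i| / (π * lam)) with hε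
  have hεpos : ∀ i, 0 < ε i := fun i => Real.sqrt_pos.2 (by have := abs_pos.2 (hc0 i); positivity)
  have hεsq : ∀ i, lam * (π * ε i ^ 2) = |c i| := fun i => by
    rw [hε, Real.sq_sqrt (by positivity)]
    field_simp
  have hεδ : ∀ i, ε i ≤ δ := fun i => by
    refine Real.sqrt_le_iff.2 ⟨hδ.le, ?_⟩
    have h1 : |c i| ≤ T :=
      Finset.single_le_sum (f := fun i => |c i|) (fun _ _ => abs_nonneg _) (Finset.mem_univ i)
    have h2 : T / (π * δ ^ 2) ≤ lam := by linarith
    rw [div_le_iff₀ (by positivity)] at h2 ⊢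
    linarith
  set a : Fin p → ℝ := fun i => Real.sign (c i) * lam with ha
  have hsign : ∀ i, Real.sign (c i) * |c i| = c i := fun i => by
    rcases lt_or_gt_of_ne (hc0 i) with hi | hi
    · rw [Real.sign_of_neg hi, abs_of_neg hi]
      ring
    · rw [Real.sign_of_pos hi, abs_of_pos hi]
      ring
  have hsign2 : ∀ i, Real.sign (c i) * Real.sign (c i) = 1 := fun i => by
    rcases lt_or_gt_of_ne (hc0 i) with hi | hi
    · simp [Real.sign_of_neg hi]
    · simp [Real.sign_of_pos hi]
  have haa : ∀ i, a i * a i = lam * lam := fun i => by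
    simp only [ha]
    linear_combination lam * lam * hsign2 i
  have habs : ∀ i, |a i| = lam := fun i => by
    rw [← abs_of_pos hlam0]
    exact abs_eq_abs.2 (mul_self_eq_mul_self_iff.1 (haa i))
  set B : Fin p → Set E2 := fun i => ball (xb (Fin.castAdd l i)) (ε i) with hB
  have hBδ : ∀ i, B i ⊆ ball (xb (Fin.castAdd l i)) δ := fun i => ball_subset_ball (hεδ i)
  have hBδ' : ∀ i, B i ⊆ closedBall (xb (Fin.castAdd l i)) δ := fun i =>
    (hBδ i).trans ball_subset_closedBall
  have hBK : ∀ i, B i ⊆ K := fun i => (hBδ' i).trans (hxK _)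
  have hBm : ∀ i, MeasurableSet (B i) := fun i => measurableSet_ball
  have hvol : ∀ i, lam * volume.real (B i) = |c i| := fun i => by
    rw [hB, volume_real_ball _ (hεpos i).le, hεsq]
  set ω' : Fin p → E2 → ℝ := fun i => (B i).indicator fun _ => a i with hω'
  have hadm' : Adm δ lam ω' := by
    refine (hAdm _ _ _).2 fun i => ⟨measurable_const.indicator (hBm i), fun x hx =>
      Set.indicator_of_notMem (fun hxB => hx (hBδ i hxB)) _, ?_, Eventually.of_forall fun x => ?_⟩
    · rw [setIntegral_indicator (hBm i), Set.inter_eq_right.2 ((hBK i).trans hKD),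
        setIntegral_const, smul_eq_mul]
      simp only [ha]
      linear_combination Real.sign (c i) * hvol i + hsign i
    · have : Real.sign (κ (Fin.castAdd l i)) * ω' i x = (B i).indicator (fun _ => lam) x := by
        by_cases hx : x ∈ B i
        · simp only [hω', Set.indicator_of_mem hx, ha]
          linear_combination lam * hsign2 i
        · simp [hω', hx]
      rw [this]
      exact ⟨Set.indicator_nonneg (fun _ _ => hlam0.le) x,
        Set.indicator_le_self' (fun _ _ => hlam0.le) x⟩
  have hψM : ∀ ν : Fin p → E2 → ℝ, Adm δ lam ν → ∀ j, |ψ (∑ i, ν i) (z j)| ≤ M * T := by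
    intro ν hν j
    rw [hAdm] at hν
    rw [hψ]
    refine abs_integral_mul_sum_le (c := c) hc0 (fun i => (hν i).2.2.1)
      (fun i => (hν i).2.2.2.mono fun x hx => hx.1) fun i x hx => ?_
    refine hGM (Fin.natAdd p j) (Fin.castAdd l i) (fun hji => ?_) _ (hz j) _
      (ball_subset_closedBall (by_contra fun hxn => hx ((hν i).2.1 x hxn)))
    have := congrArg Fin.val hji
    simp only [Fin.val_natAdd, Fin.val_castAdd] at this
    omega
  have hψS : ∀ ν : Fin p → E2 → ℝ, Adm δ lam ν →
      |∑ j, κ (Fin.natAdd p j) * ψ (∑ i, ν i) (z j)| ≤ S * (M * T) := by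
    intro ν hν
    refine (Finset.abs_sum_le_sum_abs _ _).trans ?_
    rw [hS, Finset.sum_mul]
    refine Finset.sum_le_sum fun j _ => ?_
    rw [abs_mul]
    exact mul_le_mul_of_nonneg_left (hψM ν hν j) (abs_nonneg _)
  have hEcomp : En (∑ i, ω' i) - 2 * (S * (M * T)) ≤ En (∑ i, ωs i) := by
    have h1 := hmax ω' z hadm' hz
    rw [hEE, hEE] at h1
    have h2 := abs_le.1 (hψS ω' hadm')
    have h3 := abs_le.1 (hψS ωs hadm)
    linarith [h2.1, h3.2]
  have hself : ∀ i, ∀ x ∈ B i, ∀ y ∈ B i, x ≠ y →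
      -(1 / (2 * π)) * Real.log (ε i) - M ≤ G x y := by
    intro i x hx y hy hxy
    have hd0 : 0 < dist x y := dist_pos.2 hxy
    have hd : dist x y ≤ 2 * ε i := by
      have := dist_triangle_right x y (xb (Fin.castAdd l i))
      have h1 := mem_ball.1 hx
      have h2 := mem_ball.1 hy
      linarith
    have hlog : Real.log (dist x y) ≤ Real.log 2 + Real.log (ε i) := by
      rw [← Real.log_mul two_ne_zero (hεpos i).ne']
      exact Real.log_le_log hd0 hd
    have hh := hM2 (x, y) ⟨hBK i hx, hBK i hy⟩
    rw [Real.norm_eq_abs] at hh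
    have hh2 := (abs_le.1 (hh.trans (le_abs_self M2))).2
    have hmul := mul_le_mul_of_nonneg_left hlog (by positivity : 0 ≤ 1 / (2 * π))
    rw [hG, one_div (dist x y), Real.log_inv, hM]
    have h1 := abs_nonneg M1
    have h2 : Real.log 2 / (2 * π) = 1 / (2 * π) * Real.log 2 := by ring
    rw [h2]
    simp only at hh2
    linarith
  have hlower := sum_le_double_integral hKD hGint hBm hBK
    (fun i => measure_ball_lt_top.ne) a
    (fun i j => (if i = j then -(1 / (2 * π)) * Real.log (ε i) else 0) - M) (by
      intro i j x hx y hy hxy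
      rcases eq_or_ne i j with rfl | hij
      · rw [if_pos rfl, mul_assoc, mul_assoc, habs, haa]
        exact mul_le_mul_of_nonneg_right (hself i x hx y hy hxy) (by positivity)
      · rw [if_neg hij, zero_sub]
        have h1 : |G x y * a i * a j| ≤ M * |a i| * |a j| := by
          rw [abs_mul, abs_mul]
          gcongr
          exact hGM _ _ (fun hc => hij (Fin.castAdd_injective p l hc)) x (hBδ' i hx) y (hBδ' j hy)
        have := (abs_le.1 h1).1
        linarith)
  simp only [habs, hvol] at hlower
  have hsum : ∑ i, ∑ j, ((if i = j then -(1 / (2 * π)) * Real.log (ε i) else 0) - M) * |c i| * |c j|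
      = -(1 / (2 * π)) * ∑ i, c i ^ 2 * Real.log (ε i) - M * T ^ 2 := by
    have h1 : ∀ i, ∑ j, ((if i = j then -(1 / (2 * π)) * Real.log (ε i) else 0) - M) * |c i| * |c j|
        = -(1 / (2 * π)) * (c i ^ 2 * Real.log (ε i)) - M * T * |c i| := by
      intro i
      simp only [sub_mul, ite_mul, zero_mul, Finset.sum_sub_distrib, Finset.sum_ite_eq,
        Finset.mem_univ, if_true, ← Finset.mul_sum]
      rw [← hT, ← sq_abs (c i)]
      ring
    rw [Finset.sum_congr rfl fun i _ => h1 i, Finset.sum_sub_distrib, ← Finset.mul_sum,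
      ← Finset.mul_sum, ← hT]
    ring
  rw [hsum] at hlower
  have hEn' := hEn (∑ i, ω' i)
  have hπ : -(1 / (4 * π)) * ∑ i, c i ^ 2 * Real.log (ε i)
      = 1 / 2 * (-(1 / (2 * π)) * ∑ i, c i ^ 2 * Real.log (ε i)) := by
    ring
  rw [hπ]
  linarith
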